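/- There exist uncountably many transcendental entire functions f : ℂ → ℂ such that f is given on all of ℂ by a power series f(z) = Σ_{n≥0} a_n zⁿ with all coefficients a_n rational, and such that f(Q̄) ⊆ Q̄ and f⁻¹(Q̄) ⊆ Q̄, where Q̄ denotes the set of algebraic numbers in ℂ. -/

import Mathlib

open Polynomial

lemma mq_coeff_bound (G : ℚ[X]) (r : ℝ) (hr : 0 ≤ r) :
    ∃ B : ℝ, 0 ≤ B ∧ ∀ n, |(G.coeff n : ℝ)| * r ^ n ≤ B := by
  refine ⟨∑ n ∈ G.support, |(G.coeff n : ℝ)| * r ^ n,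
    Finset.sum_nonneg fun n _ => by positivity, fun n => ?_⟩
  by_cases h : n ∈ G.support
  · exact Finset.single_le_sum (f := fun n => |(G.coeff n : ℝ)| * r ^ n)
      (fun n _ => by positivity) h
  · have : G.coeff n = 0 := by simpa using h
    rw [this]
    simp only [Rat.cast_zero, abs_zero, zero_mul]
    exact Finset.sum_nonneg fun n _ => by positivity

lemma mq_div_bound (G p : ℚ[X]) (m : ℚ[X]) (a : ℂ) (hm : aeval a m = 0)
    (hd : m.comp p ∣ G) (r : ℝ) :
    ∃ B : ℝ, 0 ≤ B ∧ ∀ z : ℂ, ‖z‖ ≤ r → ‖aeval z G‖ ≤ B * ‖aeval z p - a‖ := by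
  obtain ⟨H, rfl⟩ := hd
  have h1 : (X - C a) ∣ m.map (algebraMap ℚ ℂ) := by
    rw [dvd_iff_isRoot, IsRoot, eval_map_algebraMap, hm]
  obtain ⟨q, hq⟩ := h1
  have hc : Continuous fun z : ℂ => eval (aeval z p) q * aeval z H := by
    fun_prop
  obtain ⟨B, hB⟩ := (isCompact_closedBall (0:ℂ) r).exists_bound_of_continuousOn hc.continuousOn
  refine ⟨max B 0, le_max_right _ _, fun z hz => ?_⟩
  have h2 : aeval z (m.comp p * H) = (eval (aeval z p) q * aeval z H) * (aeval z p - a) := by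
    rw [map_mul, aeval_comp, ← eval_map_algebraMap m, hq]
    simp only [eval_mul, eval_sub, eval_X, eval_C]
    ring
  rw [h2, norm_mul]
  have := hB z (by simpa using hz)
  gcongr
  exact this.trans (le_max_left _ _)

lemma mq_step (α : ℕ → ℂ) (hα : ∀ j, IsAlgebraic ℚ (α j)) (k : ℕ) (p : ℚ[X])
    (hp : 0 < p.natDegree) (c : ℕ → ℂ) :
    ∃ p' : ℚ[X], (∀ n ≤ p.natDegree, p'.coeff n = p.coeff n) ∧
      p.natDegree < p'.natDegree ∧
      ((p'.coeff p'.natDegree : ℚ) : ℂ) ≠ c p'.natDegree ∧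
      (∀ n, p.natDegree < n → |(p'.coeff n : ℝ)| * ((k : ℝ) + 1) ^ n ≤ 1) ∧
      (∀ j ≤ k, aeval (α j) p' = aeval (α j) p) ∧
      (∀ j ≤ k, ∀ z : ℂ, ‖z‖ ≤ k →
        ‖aeval z p' - aeval z p‖ ≤ 1 / ((k : ℝ) + 2) ^ 2 * ‖aeval z p - α j‖) := by
  choose m hm0 hm using hα
  set d := p.natDegree with hd
  set G : ℚ[X] := X ^ (d + 1) * ∏ j ∈ Finset.range (k + 1), ((m j).comp p * m j) with hG
  have hmc : ∀ j, (m j).comp p ≠ 0 := by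
    intro j h
    rw [comp_eq_zero_iff] at h
    rcases h with h | h
    · exact hm0 j h
    · rw [h.2, natDegree_C] at hd; omega
  have hP : ∏ j ∈ Finset.range (k + 1), ((m j).comp p * m j) ≠ 0 :=
    Finset.prod_ne_zero_iff.2 fun j _ => mul_ne_zero (hmc j) (hm0 j)
  have hG0 : G ≠ 0 := mul_ne_zero (pow_ne_zero _ X_ne_zero) hP
  have hGd : d < G.natDegree := by
    rw [hG, natDegree_mul (pow_ne_zero _ X_ne_zero) hP, natDegree_X_pow]; omega
  have hGc : ∀ n ≤ d, G.coeff n = 0 := by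
    intro n hn
    rw [hG, mul_comm, coeff_mul_X_pow', if_neg (by omega)]
  have hdvd : ∀ j ≤ k, (m j).comp p * m j ∣ G := fun j hj =>
    Dvd.dvd.mul_left (Finset.dvd_prod_of_mem _ (Finset.mem_range.2 (by omega))) _
  obtain ⟨B0, hB0, hB0'⟩ := mq_coeff_bound G ((k:ℝ)+1) (by positivity)
  have hB : ∀ j, ∃ B : ℝ, 0 ≤ B ∧ (j ≤ k → ∀ z : ℂ, ‖z‖ ≤ k →
      ‖aeval z G‖ ≤ B * ‖aeval z p - α j‖) := by
    intro j
    by_cases hj : j ≤ k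
    · obtain ⟨B, h1, h2⟩ := mq_div_bound G p (m j) (α j) (hm j)
        ((dvd_mul_right _ _).trans (hdvd j hj)) k
      exact ⟨B, h1, fun _ => h2⟩
    · exact ⟨0, le_rfl, fun h => absurd h hj⟩
  choose B hB1 hB2 using hB
  set S : ℝ := B0 + ∑ j ∈ Finset.range (k + 1), B j with hS
  have hS1 : B0 ≤ S := by
    have : 0 ≤ ∑ j ∈ Finset.range (k + 1), B j := Finset.sum_nonneg fun j _ => hB1 j
    linarith
  have hS2 : ∀ j ≤ k, B j ≤ S := by
    intro j hj
    have : B j ≤ ∑ j ∈ Finset.range (k + 1), B j :=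
      Finset.single_le_sum (fun j _ => hB1 j) (Finset.mem_range.2 (by omega))
    linarith
  have hS0 : 0 ≤ S := hB0.trans hS1
  obtain ⟨N, hN⟩ := exists_nat_gt (S * ((k:ℝ) + 2) ^ 2)
  have hN0 : (0:ℝ) < N := lt_of_le_of_lt (by positivity) hN
  -- choose ε
  obtain ⟨ε, hε0, hε1, hε2⟩ : ∃ ε : ℚ, 0 < ε ∧ (ε : ℝ) ≤ 1 / N ∧
      ((ε * G.leadingCoeff : ℚ) : ℂ) ≠ c G.natDegree := by
    have hl : G.leadingCoeff ≠ 0 := leadingCoeff_ne_zero.2 hG0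
    have hN0' : (0:ℚ) < N := by exact_mod_cast hN0
    by_cases h : (((1 / N : ℚ) * G.leadingCoeff : ℚ) : ℂ) = c G.natDegree
    · refine ⟨1 / N / 2, by positivity, ?_, ?_⟩
      · push_cast
        have : (0:ℝ) < 1 / N := by positivity
        linarith
      · rw [← h]
        intro h'
        have h'' := Rat.cast_injective h'
        have h3 := mul_right_cancel₀ hl h''
        have : (0:ℚ) < 1 / N := by positivity
        linarith
    · exact ⟨1 / N, by positivity, by push_cast; exact le_rfl, h⟩
  have hεr : (0:ℝ) < ε := by exact_mod_cast hε0
  have hεS : (ε:ℝ) * S ≤ 1 / ((k:ℝ)+2)^2 := by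
    calc (ε:ℝ) * S ≤ 1 / N * S := by gcongr
      _ ≤ _ := by
        rw [div_mul_eq_mul_div, one_mul, div_le_div_iff₀ hN0 (by positivity)]
        linarith
  have hεS1 : (ε:ℝ) * S ≤ 1 := hεS.trans (by
    rw [div_le_one (by positivity)]
    have : (0:ℝ) ≤ k := by positivity
    nlinarith)
  have hdeg : (p + C ε * G).natDegree = G.natDegree := by
    rw [natDegree_add_eq_right_of_natDegree_lt] <;> rw [natDegree_C_mul hε0.ne']
    exact hGd
  have hpc : ∀ n, d < n → (p + C ε * G).coeff n = ε * G.coeff n := by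
    intro n hn
    rw [coeff_add, coeff_C_mul, coeff_eq_zero_of_natDegree_lt hn, zero_add]
  refine ⟨p + C ε * G, ?_, ?_, ?_, ?_, ?_, ?_⟩
  · intro n hn
    rw [coeff_add, coeff_C_mul, hGc n hn]; simp
  · rw [hdeg]; exact hGd
  · rw [hdeg, hpc _ hGd]; exact hε2
  · intro n hn
    rw [hpc n hn]
    push_cast
    rw [abs_mul, abs_of_pos hεr, mul_assoc]
    calc (ε:ℝ) * _ ≤ ε * S := by
          gcongr
          exact (hB0' n).trans hS1
      _ ≤ 1 := hεS1
  · intro j hj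
    obtain ⟨H, hH⟩ := hdvd j hj
    rw [map_add, hH]
    simp [hm j]
  · intro j hj z hz
    have : aeval z (p + C ε * G) - aeval z p = (ε:ℂ) * aeval z G := by
      simp [aeval_C]
    rw [this, norm_mul]
    have h1 : ‖(ε:ℂ)‖ = ε := by
      rw [Complex.norm_ratCast, abs_of_pos hεr]
    rw [h1]
    calc (ε:ℝ) * ‖aeval z G‖ ≤ ε * (S * ‖aeval z p - α j‖) := by
          gcongr
          exact (hB2 j hj z hz).trans (by gcongr; exact hS2 j hj)
      _ = (ε * S) * ‖aeval z p - α j‖ := by ring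
      _ ≤ _ := by gcongr

lemma mq_fps (a : ℕ → ℂ) (f : ℂ → ℂ) (h : ∀ z : ℂ, HasSum (fun n : ℕ => a n * z ^ n) (f z)) :
    HasFPowerSeriesOnBall f (FormalMultilinearSeries.ofScalars ℂ a) 0 ⊤ where
  r_le := by
    refine le_of_eq (ENNReal.eq_top_of_forall_nnreal_le fun r => ?_).symm
    apply FormalMultilinearSeries.le_radius_of_tendsto (l := 0)
    have h1 := (h (r : ℂ)).summable.tendsto_atTop_zero.norm
    refine (h1.congr fun n => ?_).trans (by simp)
    rw [FormalMultilinearSeries.ofScalars_norm]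
    simp
  r_pos := by simp
  hasSum := by
    intro y _
    rw [FormalMultilinearSeries.ofScalars_apply_eq', zero_add]
    simpa using h y

lemma mq_diff (a : ℕ → ℂ) (f : ℂ → ℂ) (h : ∀ z : ℂ, HasSum (fun n : ℕ => a n * z ^ n) (f z)) :
    Differentiable ℂ f := by
  have := (mq_fps a f h).differentiableOn
  intro z
  exact (this z (by simp)).differentiableAt (by simp)

lemma mq_coeff (a : ℕ → ℂ) (f : ℂ → ℂ) (h : ∀ z : ℂ, HasSum (fun n : ℕ => a n * z ^ n) (f z))
    (n : ℕ) : (n.factorial : ℂ) * a n = iteratedDeriv n f 0 := by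
  have := (mq_fps a f h).factorial_smul 1 n
  rw [FormalMultilinearSeries.ofScalars_apply_eq] at this
  rw [iteratedDeriv_eq_iteratedFDeriv, ← this]
  simp

lemma mq_poly_upper (q : ℂ[X]) : ∃ (K : ℝ) (N : ℕ), 0 ≤ K ∧
    ∀ z : ℂ, 1 ≤ ‖z‖ → ‖q.eval z‖ ≤ K * ‖z‖ ^ N := by
  refine ⟨∑ i ∈ Finset.range (q.natDegree + 1), ‖q.coeff i‖, q.natDegree,
    Finset.sum_nonneg fun _ _ => norm_nonneg _, fun z hz => ?_⟩
  rw [eval_eq_sum_range, Finset.sum_mul]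
  refine (norm_sum_le _ _).trans (Finset.sum_le_sum fun i hi => ?_)
  rw [norm_mul, norm_pow]
  gcongr
  have := Finset.mem_range.1 hi; omega

lemma mq_poly_lower (q : ℂ[X]) (hq : q ≠ 0) : ∃ (δ R : ℝ), 0 < δ ∧
    ∀ z : ℂ, R ≤ ‖z‖ → δ ≤ ‖q.eval z‖ := by
  by_cases hd : 0 < q.degree
  · have h := q.tendsto_norm_atTop hd (l := Filter.comap norm Filter.atTop)
      (z := fun z : ℂ => z) Filter.tendsto_comap
    have h1 := h.eventually_ge_atTop 1
    rw [Filter.eventually_comap] at h1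
    obtain ⟨R, hR⟩ := Filter.eventually_atTop.1 h1
    exact ⟨1, R, one_pos, fun z hz => hR _ hz z rfl⟩
  · rw [eq_C_of_degree_le_zero (not_lt.1 hd)] at hq ⊢
    refine ⟨‖q.coeff 0‖, 0, ?_, fun z _ => by simp⟩
    rw [norm_pos_iff]
    rintro h
    exact hq (by rw [h, C_0])

lemma mq_growth (Q : ℂ[X][X]) (hQ : Q ≠ 0) (f : ℂ → ℂ)
    (h : ∀ z, (Q.map (evalRingHom z)).eval (f z) = 0) :
    ∃ (K R : ℝ) (N : ℕ), 0 ≤ K ∧ ∀ z : ℂ, R ≤ ‖z‖ → ‖f z‖ ≤ K * ‖z‖ ^ N := by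
  obtain ⟨δ, R, hδ, hR⟩ := mq_poly_lower Q.leadingCoeff (leadingCoeff_ne_zero.2 hQ)
  choose K N hK hKN using fun i => mq_poly_upper (Q.coeff i)
  set K' := ∑ i ∈ Finset.range Q.natDegree, K i
  set N' := ∑ i ∈ Finset.range Q.natDegree, N i
  have hK' : 0 ≤ K' := Finset.sum_nonneg fun i _ => hK i
  refine ⟨K' / δ + 1, max R 1, N', by positivity, fun z hz => ?_⟩
  have hz1 : 1 ≤ ‖z‖ := (le_max_right _ _).trans hz
  have hlz := hR z ((le_max_left _ _).trans hz)
  have hl0 : evalRingHom z Q.leadingCoeff ≠ 0 := by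
    rw [coe_evalRingHom, ← norm_pos_iff]; linarith
  have hnd : (Q.map (evalRingHom z)).natDegree = Q.natDegree :=
    natDegree_map_of_leadingCoeff_ne_zero _ hl0
  have hlc : (Q.map (evalRingHom z)).leadingCoeff = eval z Q.leadingCoeff := by
    rw [leadingCoeff_map_of_leadingCoeff_ne_zero _ hl0, coe_evalRingHom]
  have hne : Q.map (evalRingHom z) ≠ 0 := by
    rw [← leadingCoeff_ne_zero, hlc]; exact hl0
  have hb := IsRoot.norm_lt_cauchyBound hne (h z)
  have hsup : (Finset.range Q.natDegree).sup (fun i => ‖(Q.map (evalRingHom z)).coeff i‖₊) ≤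
      Real.toNNReal (K' * ‖z‖ ^ N') := by
    refine Finset.sup_le fun i hi => ?_
    refine NNReal.coe_le_coe.1 ?_
    rw [Real.coe_toNNReal _ (by positivity)]
    simp only [coe_nnnorm, coeff_map, coe_evalRingHom]
    refine (hKN i z hz1).trans ?_
    gcongr
    · exact Finset.single_le_sum (fun i _ => hK i) hi
    · exact Finset.single_le_sum (fun i _ => Nat.zero_le (N i)) hi
  have hb' : ‖f z‖ < (cauchyBound (Q.map (evalRingHom z)) : ℝ) := by
    exact_mod_cast hb
  refine hb'.le.trans ?_
  rw [cauchyBound, hnd, hlc]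
  rw [← NNReal.coe_le_coe, Real.coe_toNNReal _ (by positivity)] at hsup
  push_cast
  have h1 : (1:ℝ) ≤ ‖z‖ ^ N' := one_le_pow₀ hz1
  calc _ ≤ (K' * ‖z‖ ^ N') / δ + 1 := by
        gcongr
    _ ≤ _ := by
        rw [add_mul, one_mul, div_mul_eq_mul_div]; gcongr

lemma mq_cauchy (f : ℂ → ℂ) (hf : Differentiable ℂ f) (K R : ℝ) (N : ℕ) (hK : 0 ≤ K)
    (h : ∀ z : ℂ, R ≤ ‖z‖ → ‖f z‖ ≤ K * ‖z‖ ^ N) (n : ℕ) (hn : N < n) :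
    iteratedDeriv n f 0 = 0 := by
  have h1 : ∀ r : ℝ, max R 1 ≤ r → ‖iteratedDeriv n f 0‖ ≤ n.factorial * K / r := by
    intro r hr
    have hr1 : 1 ≤ r := (le_max_right _ _).trans hr
    have hr0 : 0 < r := by linarith
    refine (Complex.norm_iteratedDeriv_le_of_forall_mem_sphere_norm_le (C := K * r ^ N) n hr0
      hf.diffContOnCl ?_).trans ?_
    · intro z hz
      have hz' : ‖z‖ = r := by simpa using hz
      rw [← hz']
      exact h z (by rw [hz']; exact (le_max_left _ _).trans hr)
    · rw [div_le_div_iff₀ (by positivity) hr0]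
      have : r ^ N * r ≤ r ^ n := by
        rw [← pow_succ]; exact pow_le_pow_right₀ hr1 hn
      calc _ = (n.factorial * K) * (r ^ N * r) := by ring
        _ ≤ _ := by gcongr
  have h2 : Filter.Tendsto (fun r : ℝ => n.factorial * K / r) Filter.atTop (nhds 0) :=
    Filter.Tendsto.div_atTop tendsto_const_nhds Filter.tendsto_id
  have h3 := ge_of_tendsto h2 (Filter.eventually_atTop.2 ⟨_, h1⟩)
  exact norm_le_zero_iff.1 h3

lemma mq_transc (a : ℕ → ℂ) (f : ℂ → ℂ) (h : ∀ z : ℂ, HasSum (fun n : ℕ => a n * z ^ n) (f z))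
    (ha : ∀ k, ∃ n, k < n ∧ a n ≠ 0) (P : MvPolynomial (Fin 2) ℂ)
    (hP : ∀ z : ℂ, MvPolynomial.eval ![z, f z] P = 0) : P = 0 := by
  by_contra hP0
  let φ : MvPolynomial (Fin 2) ℂ →+* ℂ[X][X] :=
    MvPolynomial.eval₂Hom (C.comp C) ![C X, X]
  let ψ : ℂ[X][X] →+* MvPolynomial (Fin 2) ℂ :=
    eval₂RingHom (eval₂RingHom MvPolynomial.C (MvPolynomial.X 0)) (MvPolynomial.X 1)
  have hψ : ψ.comp φ = RingHom.id _ := by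
    apply MvPolynomial.ringHom_ext
    · intro r; simp [φ, ψ]
    · intro i; fin_cases i <;> simp [φ, ψ]
  have hQ : φ P ≠ 0 := by
    intro h0
    apply hP0
    have : ψ (φ P) = P := by
      have := congrArg (fun g => g P) hψ
      simpa using this
    rw [← this, h0, map_zero]
  have hev : ∀ z w : ℂ, ((φ P).map (evalRingHom z)).eval w = MvPolynomial.eval ![z, w] P := by
    intro z w
    have : ((evalRingHom w).comp (mapRingHom (evalRingHom z))).comp φ
        = MvPolynomial.eval ![z, w] := by
      apply MvPolynomial.ringHom_ext
      · intro r; simp [φ]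
      · intro i; fin_cases i <;> simp [φ]
    rw [← this]; simp
  obtain ⟨K, R, N, hK, hKR⟩ := mq_growth (φ P) hQ f (fun z => by rw [hev, hP])
  obtain ⟨n, hn, hn0⟩ := ha N
  have h1 := mq_cauchy f (mq_diff a f h) K R N hK hKR n hn
  rw [← mq_coeff a f h] at h1
  exact hn0 ((mul_eq_zero.1 h1).resolve_left (by exact_mod_cast n.factorial_ne_zero))

lemma mq_seq (α : ℕ → ℂ) (hα : ∀ j, IsAlgebraic ℚ (α j)) (c : ℕ → ℕ → ℂ) :
    ∃ p : ℕ → ℚ[X], 0 < (p 0).natDegree ∧ ∀ k,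
      (∀ n ≤ (p k).natDegree, (p (k+1)).coeff n = (p k).coeff n) ∧
      (p k).natDegree < (p (k+1)).natDegree ∧
      (((p (k+1)).coeff (p (k+1)).natDegree : ℚ) : ℂ) ≠ c k (p (k+1)).natDegree ∧
      (∀ n, (p k).natDegree < n → |((p (k+1)).coeff n : ℝ)| * ((k : ℝ) + 1) ^ n ≤ 1) ∧
      (∀ j ≤ k, aeval (α j) (p (k+1)) = aeval (α j) (p k)) ∧
      (∀ j ≤ k, ∀ z : ℂ, ‖z‖ ≤ k →
        ‖aeval z (p (k+1)) - aeval z (p k)‖ ≤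
          1 / ((k : ℝ) + 2) ^ 2 * ‖aeval z (p k) - α j‖) := by
  choose! F hF using fun (k : ℕ) (p : ℚ[X]) (hp : 0 < p.natDegree) => mq_step α hα k p hp (c k)
  let p : ℕ → ℚ[X] := fun n => Nat.rec X (fun k q => F k q) n
  have hp0 : p 0 = X := rfl
  have hps : ∀ k, p (k+1) = F k (p k) := fun k => rfl
  have hpos : ∀ k, 0 < (p k).natDegree := by
    intro k
    induction k with
    | zero => rw [hp0, natDegree_X]; exact one_pos
    | succ k ih => rw [hps]; exact ih.trans (hF k (p k) ih).2.1
  exact ⟨p, hpos 0, fun k => by rw [hps]; exact hF k (p k) (hpos k)⟩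

lemma mq_main (α : ℕ → ℂ) (hα : ∀ j, IsAlgebraic ℚ (α j))
    (hsurj : ∀ z, IsAlgebraic ℚ z → ∃ j, α j = z) (c : ℕ → ℕ → ℂ) :
    ∃ (a : ℕ → ℚ) (f : ℂ → ℂ), (∀ z : ℂ, HasSum (fun n : ℕ => (a n : ℂ) * z ^ n) (f z)) ∧
      (∀ k, ∃ n, k < n ∧ a n ≠ 0) ∧ (∀ k, ∃ n, (a n : ℂ) ≠ c k n) ∧
      (∀ z : ℂ, IsAlgebraic ℚ z → IsAlgebraic ℚ (f z)) ∧
      (∀ z : ℂ, IsAlgebraic ℚ (f z) → IsAlgebraic ℚ z) := by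
  obtain ⟨p, hp0, hp⟩ := mq_seq α hα c
  have ht : StrictMono fun k => (p k).natDegree := strictMono_nat_of_lt_succ fun k => (hp k).2.1
  have htk : ∀ k, k ≤ (p k).natDegree := fun k => ht.le_apply
  have hst : ∀ k l, k ≤ l → ∀ n ≤ (p k).natDegree, (p l).coeff n = (p k).coeff n := by
    intro k l hkl
    induction l, hkl using Nat.le_induction with
    | base => intro n _; rfl
    | succ l hkl ih =>
      intro n hn
      rw [(hp l).1 n (hn.trans (ht.monotone hkl)), ih n hn]
  set a : ℕ → ℚ := fun n => (p n).coeff n with ha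
  have hac : ∀ k, ∀ n ≤ (p k).natDegree, a n = (p k).coeff n := by
    intro k n hn
    rcases le_total k n with h | h
    · exact hst k n h n hn
    · exact (hst n k h n (htk n)).symm
  have hbd : ∀ k n, (p k).natDegree < n → |(a n : ℝ)| * ((k : ℝ) + 1) ^ n ≤ 1 := by
    intro k n hn
    have key : ∀ l, k ≤ l → n ≤ (p l).natDegree →
        |((p l).coeff n : ℝ)| * ((k : ℝ) + 1) ^ n ≤ 1 := by
      intro l hkl
      induction l, hkl using Nat.le_induction with
      | base => intro h; omega
      | succ l hkl ih =>
        intro h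
        by_cases h' : n ≤ (p l).natDegree
        · rw [(hp l).1 n h']; exact ih h'
        · refine le_trans ?_ ((hp l).2.2.2.1 n (by omega))
          gcongr
    exact key n ((htk k).trans hn.le) (htk n)
  have hsum : ∀ z : ℂ, Summable fun n : ℕ => (a n : ℂ) * z ^ n := by
    intro z
    obtain ⟨k, hk⟩ := exists_nat_ge ‖z‖
    have hk1 : (0:ℝ) < (k:ℝ) + 1 := by positivity
    have hr : ‖z‖ / ((k:ℝ) + 1) < 1 := by rw [div_lt_one hk1]; linarith
    refine Summable.of_norm_bounded_eventually_nat
      (summable_geometric_of_lt_one (by positivity) hr) ?_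
    filter_upwards [Filter.eventually_gt_atTop (p k).natDegree] with n hn
    rw [norm_mul, norm_pow, Complex.norm_ratCast, div_pow, le_div_iff₀ (by positivity)]
    calc _ = (|(a n : ℝ)| * ((k : ℝ) + 1) ^ n) * ‖z‖ ^ n := by ring
      _ ≤ 1 * ‖z‖ ^ n := by gcongr; exact hbd k n hn
      _ = _ := one_mul _
  choose f hf using hsum
  have hps : ∀ (k : ℕ) (z : ℂ), aeval z (p k) =
      ∑ n ∈ Finset.range ((p k).natDegree + 1), (a n : ℂ) * z ^ n := by
    intro k z
    rw [aeval_eq_sum_range]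
    refine Finset.sum_congr rfl fun n hn => ?_
    rw [hac k n (by have := Finset.mem_range.1 hn; omega), Algebra.smul_def]
    simp
  have hlim : ∀ z : ℂ, Filter.Tendsto (fun k => aeval z (p k)) Filter.atTop (nhds (f z)) := by
    intro z
    simp only [hps]
    exact (hf z).tendsto_sum_nat.comp
      ((Filter.tendsto_add_atTop_nat 1).comp ht.tendsto_atTop)
  have hpalg : ∀ (k : ℕ) (z : ℂ), IsAlgebraic ℚ z → IsAlgebraic ℚ (aeval z (p k)) := by
    intro k z hz
    rw [aeval_eq_sum_range]
    exact (IsIntegral.sum _ fun i _ => (hz.isIntegral.pow i).smul _).isAlgebraic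
  refine ⟨a, f, hf, ?_, ?_, ?_, ?_⟩
  · intro k
    refine ⟨(p (k+1)).natDegree, htk (k+1), ?_⟩
    rw [hac (k+1) _ le_rfl, coeff_natDegree]
    apply leadingCoeff_ne_zero.2
    rintro h
    have := htk (k+1)
    rw [h, natDegree_zero] at this
    omega
  · intro k
    refine ⟨(p (k+1)).natDegree, ?_⟩
    rw [hac (k+1) _ le_rfl]
    exact (hp k).2.2.1
  · intro z hz
    obtain ⟨j, rfl⟩ := hsurj z hz
    have hc : ∀ k, j ≤ k → aeval (α j) (p k) = aeval (α j) (p j) := by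
      intro k hk
      induction k, hk using Nat.le_induction with
      | base => rfl
      | succ k hk ih => rw [(hp k).2.2.2.2.1 j hk, ih]
    have : f (α j) = aeval (α j) (p j) := tendsto_nhds_unique (hlim (α j))
      (tendsto_const_nhds.congr' (Filter.eventually_atTop.2 ⟨j, fun k hk => (hc k hk).symm⟩))
    rw [this]
    exact hpalg j _ hz
  · intro z hz
    obtain ⟨j, hj⟩ := hsurj _ hz
    obtain ⟨k0, hk0⟩ := exists_nat_ge ‖z‖
    set m := max j k0 + 1 with hm
    have hjm : j ≤ m := by omega
    have hzm : ∀ k, m ≤ k → ‖z‖ ≤ k := by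
      intro k hk
      refine hk0.trans ?_
      have : k0 ≤ k := by omega
      exact_mod_cast this
    by_cases hmz : aeval z (p m) = α j
    · -- `z` is a root of a nonconstant polynomial over the algebraic numbers
      obtain ⟨q, hq0, hq⟩ := hα j
      refine ⟨q.comp (p m), ?_, by rw [aeval_comp, hmz, hq]⟩
      intro h
      rw [comp_eq_zero_iff] at h
      rcases h with h | h
      · exact hq0 h
      · have := htk m
        rw [h.2, natDegree_C] at this
        omega
    · exfalso
      have hpos : 0 < ‖aeval z (p m) - α j‖ := norm_pos_iff.2 (sub_ne_zero.2 hmz)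
      set D := ‖aeval z (p m) - α j‖ with hD
      have hlow : ∀ k, m ≤ k →
          D / 2 * (((k:ℝ) + 2) / ((k:ℝ) + 1)) ≤ ‖aeval z (p k) - α j‖ := by
        intro k hk
        induction k, hk using Nat.le_induction with
        | base =>
          rw [← hD]
          have : ((m:ℝ) + 2) / ((m:ℝ) + 1) ≤ 2 := by
            rw [div_le_iff₀ (by positivity)]
            have : (0:ℝ) ≤ m := by positivity
            linarith
          nlinarith
        | succ k hk ih =>
          have h1 := (hp k).2.2.2.2.2 j (hjm.trans hk) z (hzm k hk)
          have h2 : ‖aeval z (p k) - α j‖ ≤ ‖aeval z (p (k+1)) - α j‖ +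
              ‖aeval z (p (k+1)) - aeval z (p k)‖ := by
            have := norm_sub_le (aeval z (p (k+1)) - α j) (aeval z (p (k+1)) - aeval z (p k))
            refine le_trans (le_of_eq ?_) this
            congr 1; ring
          have h3 : (1 - 1 / ((k : ℝ) + 2) ^ 2) * ‖aeval z (p k) - α j‖ ≤
              ‖aeval z (p (k+1)) - α j‖ := by linarith
          refine le_trans ?_ h3
          have h4 : (0:ℝ) ≤ 1 - 1 / ((k : ℝ) + 2) ^ 2 := by
            rw [sub_nonneg, div_le_one (by positivity)]
            have : (0:ℝ) ≤ k := by positivity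
            nlinarith
          refine le_trans (le_of_eq ?_) (mul_le_mul_of_nonneg_left ih h4)
          have e1 : (k:ℝ) + 1 ≠ 0 := by positivity
          have e2 : (k:ℝ) + 2 ≠ 0 := by positivity
          push_cast
          have e3 : (k:ℝ) + 1 + 1 = k + 2 := by ring
          rw [e3]
          field_simp
          ring
      have hlow' : ∀ k, m ≤ k → D / 2 ≤ ‖aeval z (p k) - α j‖ := by
        intro k hk
        refine le_trans ?_ (hlow k hk)
        have : (1:ℝ) ≤ ((k:ℝ) + 2) / ((k:ℝ) + 1) := by
          rw [one_le_div (by positivity)]; linarith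
        nlinarith
      have hl := ((hlim z).sub_const (α j)).norm
      rw [← hj, sub_self, norm_zero] at hl
      have := ge_of_tendsto hl (Filter.eventually_atTop.2 ⟨m, hlow'⟩)
      linarith

/-- There exist uncountably many transcendental entire functions `f : ℂ → ℂ`
given everywhere by a power series with rational coefficients, mapping algebraic numbers
to algebraic numbers, and whose preimage of the algebraic numbers consists of algebraic
numbers. -/
theorem mahler_question_uncountably_many :
    ¬ Set.Countable {f : ℂ → ℂ |
      Differentiable ℂ f ∧
      (∀ P : MvPolynomial (Fin 2) ℂ,
        (∀ z : ℂ, MvPolynomial.eval ![z, f z] P = 0) → P = 0) ∧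
      (∃ a : ℕ → ℚ, ∀ z : ℂ, HasSum (fun n : ℕ => (a n : ℂ) * z ^ n) (f z)) ∧
      (∀ z : ℂ, IsAlgebraic ℚ z → IsAlgebraic ℚ (f z)) ∧
      (∀ z : ℂ, IsAlgebraic ℚ (f z) → IsAlgebraic ℚ z)} := by
  intro hcount
  obtain ⟨e, he⟩ := Set.countable_iff_exists_subset_range.1 hcount
  obtain ⟨α, hα⟩ := (Algebraic.countable ℚ ℂ).exists_eq_range ⟨0, isAlgebraic_zero⟩
  have hα1 : ∀ j, IsAlgebraic ℚ (α j) := fun j => by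
    have : α j ∈ {x : ℂ | IsAlgebraic ℚ x} := hα ▸ Set.mem_range_self j
    exact this
  have hα2 : ∀ z, IsAlgebraic ℚ z → ∃ j, α j = z := fun z hz => by
    have : z ∈ Set.range α := hα ▸ hz
    exact this
  obtain ⟨a, f, hf, ha, hc, h1, h2⟩ := mq_main α hα1 hα2
    (fun k n => iteratedDeriv n (e k) 0 / (n.factorial : ℂ))
  have hmem := he (show f ∈ _ from ⟨mq_diff _ f hf, fun P hP => mq_transc _ f hf
    (fun k => by
      obtain ⟨n, hn, hn0⟩ := ha k
      exact ⟨n, hn, by exact_mod_cast hn0⟩) P hP, ⟨a, hf⟩, h1, h2⟩)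
  obtain ⟨k, hk⟩ := hmem
  obtain ⟨n, hn⟩ := hc k
  apply hn
  simp only [hk]
  rw [← mq_coeff _ f hf n, mul_div_cancel_left₀]
  exact_mod_cast n.factorial_ne_zero
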